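/- Under the hypotheses of the Multiple Deletion Theorem (conditions (1),(2),(3) on a free arrangement 𝒜 with exponents (1,d₂,…,d_ℓ), 1<d₂, hyperplanes H₂,…,H_q), for any subset I ⊆ {2,…,q} the arrangement 𝒜_{−I} = 𝒜 ∖ {Hᵢ : i ∈ I} is free, with basis θ_E, {ηᵢ}_{i∈I}, {αᵢηᵢ}_{i∉I, 2≤i≤q}, θ_{q+1}, …, θ_ℓ, where θ_E, α₂η₂,…,α_qη_q, θ_{q+1},…,θ_ℓ is the basis of D(𝒜) provided by MDT. -/

import Mathlib

open MvPolynomial Module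

attribute [local instance] Classical.propDecidable

namespace ArrPaper

variable {K : Type*} [Field K] {ℓ m : ℕ}

/-- The polynomial coordinate ring `S = K[x₁,…,x_ℓ]`. -/
abbrev S (K : Type*) [Field K] (ℓ : ℕ) := MvPolynomial (Fin ℓ) K

/-- A polynomial derivation of `S`, given by its values on the variables. -/
abbrev Deriv (K : Type*) [Field K] (ℓ : ℕ) := Fin ℓ → S K ℓ

/-- The linear form `∑ αᵢ xᵢ` as a polynomial. -/
noncomputable def lin (α : Fin ℓ → K) : S K ℓ := ∑ i, C (α i) * X i

/-- The value `θ(α)` of a derivation on a linear form `α`. -/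
noncomputable def applyD (θ : Deriv K ℓ) (α : Fin ℓ → K) : S K ℓ := ∑ i, C (α i) * θ i

lemma applyD_add (θ η : Deriv K ℓ) (α : Fin ℓ → K) :
    applyD (θ + η) α = applyD θ α + applyD η α := by
  simp [applyD, mul_add, Finset.sum_add_distrib]

lemma applyD_smul (f : S K ℓ) (θ : Deriv K ℓ) (α : Fin ℓ → K) :
    applyD (f • θ) α = f * applyD θ α := by
  simp only [applyD, Pi.smul_apply, smul_eq_mul, Finset.mul_sum]
  exact Finset.sum_congr rfl fun i _ => by ring

/-- The logarithmic derivation module `D(𝒜)` of an arrangement, where the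
arrangement is specified by the finite set of its defining linear forms. -/
noncomputable def logDer (A : Finset (Fin ℓ → K)) : Submodule (S K ℓ) (Deriv K ℓ) where
  carrier := {θ | ∀ α ∈ A, lin α ∣ applyD θ α}
  add_mem' := by
    intro a b ha hb α hα
    rw [applyD_add]
    exact dvd_add (ha α hα) (hb α hα)
  zero_mem' := by intro α hα; simp [applyD]
  smul_mem' := by
    intro f θ hθ β hβ
    rw [applyD_smul]
    exact (hθ β hβ).mul_left f

/-- The logarithmic derivation module `D(𝒜, m)` of a multiarrangement. -/
noncomputable def logDerM (A : Finset (Fin ℓ → K)) (mult : (Fin ℓ → K) → ℕ) :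
    Submodule (S K ℓ) (Deriv K ℓ) where
  carrier := {θ | ∀ α ∈ A, (lin α) ^ (mult α) ∣ applyD θ α}
  add_mem' := by
    intro a b ha hb α hα
    rw [applyD_add]
    exact dvd_add (ha α hα) (hb α hα)
  zero_mem' := by intro α hα; simp [applyD]
  smul_mem' := by
    intro f θ hθ β hβ
    rw [applyD_smul]
    exact (hθ β hβ).mul_left f

/-- The Euler derivation. -/
noncomputable def eulerD (K : Type*) [Field K] (ℓ : ℕ) : Deriv K ℓ := fun i => X i

/-- A derivation is homogeneous of degree `d` if all its coefficients are. -/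
def IsHomog (θ : Deriv K ℓ) (d : ℕ) : Prop := ∀ i, (θ i).IsHomogeneous d

/-- A family is a (free) basis of a submodule of the derivation module. -/
def IsBasisOf {ι : Type*} (θ : ι → Deriv K ℓ) (M : Submodule (S K ℓ) (Deriv K ℓ)) : Prop :=
  (∀ i, θ i ∈ M) ∧ LinearIndependent (S K ℓ) θ ∧ Submodule.span (S K ℓ) (Set.range θ) = M

/-- `𝒜` is free with exponents `d₁,…,d_ℓ`. -/
def IsFreeWithExp (A : Finset (Fin ℓ → K)) (d : Fin ℓ → ℕ) : Prop :=
  ∃ θ : Fin ℓ → Deriv K ℓ, IsBasisOf θ (logDer A) ∧ ∀ i, IsHomog (θ i) (d i)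

/-- `(𝒜, m)` is free with exponents `d₁,…,d_ℓ`. -/
def IsFreeWithExpM (A : Finset (Fin ℓ → K)) (mult : (Fin ℓ → K) → ℕ) (d : Fin ℓ → ℕ) : Prop :=
  ∃ θ : Fin ℓ → Deriv K ℓ, IsBasisOf θ (logDerM A mult) ∧ ∀ i, IsHomog (θ i) (d i)

/-- The hyperplane `ker α ⊆ Kˡ` attached to a linear form `α`. -/
noncomputable def hyp (α : Fin ℓ → K) : Submodule K (Fin ℓ → K) :=
  LinearMap.ker (∑ i, α i • LinearMap.proj i : (Fin ℓ → K) →ₗ[K] K)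

/-- The restriction `𝒜^H = {H ∩ L : L ∈ 𝒜'}` of an arrangement `𝒜'` to the
hyperplane `H = ker α_H`, as a finite set of subspaces. -/
noncomputable def restH (A' : Finset (Fin ℓ → K)) (αH : Fin ℓ → K) :
    Finset (Submodule K (Fin ℓ → K)) :=
  A'.image (fun β => hyp αH ⊓ hyp β)

/-- The restriction `𝒜^X = {X ∩ H : H ∈ 𝒜, X ⊄ H}` to a subspace `X`. -/
noncomputable def restArr (A : Finset (Fin ℓ → K)) (Xs : Submodule K (Fin ℓ → K)) :
    Finset (Submodule K (Fin ℓ → K)) :=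
  (A.filter (fun β => ¬ Xs ≤ hyp β)).image (fun β => Xs ⊓ hyp β)

/-- Codimension of a subspace of `Kˡ`. -/
noncomputable def codim (Xs : Submodule K (Fin ℓ → K)) : ℕ := ℓ - Module.finrank K Xs

/-- The intersection lattice `L(𝒜)`. -/
noncomputable def LSet (A : Finset (Fin ℓ → K)) : Finset (Submodule K (Fin ℓ → K)) :=
  A.powerset.image (fun b => b.inf hyp)

/-- Pullback (restriction) of polynomial functions along a linear map
`ι : Kᵐ → Kˡ`. -/
noncomputable def pullback (ι : (Fin m → K) →ₗ[K] (Fin ℓ → K)) : S K ℓ →ₐ[K] S K m :=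
  aeval (fun j => ∑ i, C (ι (Pi.single i 1) j) * X i)

/-- The (Euler) restriction of a derivation onto the subspace `im ι ≅ Kᵐ`,
computed using chosen linear forms `γ i` lifting the coordinates of `Kᵐ`. -/
noncomputable def restD (ι : (Fin m → K) →ₗ[K] (Fin ℓ → K)) (γ : Fin m → (Fin ℓ → K))
    (θ : Deriv K ℓ) : Deriv K m :=
  fun i => pullback ι (applyD θ (γ i))

/-- `γ` is a system of coordinate lifts for `ι : Kᵐ → Kˡ`. -/
def CoordLifts (ι : (Fin m → K) →ₗ[K] (Fin ℓ → K)) (γ : Fin m → (Fin ℓ → K)) : Prop :=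
  ∀ i, pullback ι (lin (γ i)) = X i

/-- `B` (a finite set of forms on `Kᵐ`) represents the restricted arrangement
`𝒜^X` via the embedding `ι : Kᵐ ≅ X ⊆ Kˡ`. -/
def Represents (B : Finset (Fin m → K)) (ι : (Fin m → K) →ₗ[K] (Fin ℓ → K))
    (A : Finset (Fin ℓ → K)) (Xs : Submodule K (Fin ℓ → K)) : Prop :=
  (∀ b ∈ B, b ≠ 0) ∧ B.image (fun b => (hyp b).map ι) = restArr A Xs ∧
    B.card = (restArr A Xs).card

/-- The restricted arrangement `𝒜^X` is free with exponents `e`. -/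
def RestFree (A : Finset (Fin ℓ → K)) (Xs : Submodule K (Fin ℓ → K)) (m : ℕ)
    (e : Fin m → ℕ) : Prop :=
  ∃ (φ : (Fin m → K) ≃ₗ[K] Xs) (B : Finset (Fin m → K)),
    Represents B (Xs.subtype ∘ₗ φ.toLinearMap) A Xs ∧ IsFreeWithExp B e

/-- The Ziegler multiplicity of a hyperplane `ker b ⊆ Kᵐ ≅ H` obtained by
restricting `𝒜` onto `H = ker α_H`. -/
noncomputable def zMult (A : Finset (Fin ℓ → K)) (αH : Fin ℓ → K)
    (ι : (Fin m → K) →ₗ[K] (Fin ℓ → K)) (b : Fin m → K) : ℕ :=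
  ((A.erase αH).filter (fun β => hyp αH ⊓ hyp β = (hyp b).map ι)).card

/-- `θ ↦ θ(α)` as an `S`-linear map. -/
noncomputable def applyDL (α : Fin ℓ → K) : Deriv K ℓ →ₗ[S K ℓ] S K ℓ where
  toFun θ := applyD θ α
  map_add' a b := applyD_add a b α
  map_smul' f θ := by simpa using applyD_smul f θ α

/-- `D_H(𝒜) = {θ ∈ D(𝒜) : θ(α_H) = 0}`. -/
noncomputable def DH (A : Finset (Fin ℓ → K)) (αH : Fin ℓ → K) :
    Submodule (S K ℓ) (Deriv K ℓ) :=
  logDer A ⊓ LinearMap.ker (applyDL αH)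

end ArrPaper

namespace ArrPaper

section basics

variable {K : Type*} [Field K] {ℓ : ℕ}

lemma irred_of_homog_one {σ : Type*} {f : MvPolynomial σ K} (hf : f.IsHomogeneous 1)
    (h0 : f ≠ 0) : Irreducible f := by
  apply MvPolynomial.irreducible_of_totalDegree_eq_one (hf.totalDegree h0)
  intro x hx
  rw [isUnit_iff_ne_zero]
  rintro rfl
  apply h0
  ext i
  simpa using hx i

lemma lin_homog (β : Fin ℓ → K) : (lin β).IsHomogeneous 1 :=
  IsHomogeneous.sum _ _ _ fun _ _ => isHomogeneous_C_mul_X _ _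

lemma lin_eq_zero {β : Fin ℓ → K} (h : lin β = 0) : β = 0 := by
  funext i
  have := congrArg (eval (Pi.single i (1 : K))) h
  simpa [lin, Pi.single_apply] using this

lemma lin_prime {β : Fin ℓ → K} (h : β ≠ 0) : Prime (lin β) :=
  (irred_of_homog_one (lin_homog β) fun h' => h (lin_eq_zero h')).prime

lemma mem_hyp {β v : Fin ℓ → K} : v ∈ hyp β ↔ eval v (lin β) = 0 := by
  simp [hyp, lin, LinearMap.sum_apply]

lemma hyp_le_of_dvd {β γ : Fin ℓ → K} (h : lin β ∣ lin γ) : hyp β ≤ hyp γ := by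
  intro v hv
  rw [mem_hyp] at *
  obtain ⟨r, hr⟩ := h
  rw [hr, map_mul, hv, zero_mul]

lemma dvd_of_hyp_le {β γ : Fin ℓ → K} (hβ : β ≠ 0) (h : hyp β ≤ hyp γ) : lin β ∣ lin γ := by
  obtain ⟨i0, hi0⟩ := Function.ne_iff.mp hβ
  simp only [Pi.zero_apply, ne_eq] at hi0
  refine ⟨C (γ i0 / β i0), ?_⟩
  have key : ∀ i, γ i = γ i0 / β i0 * β i := by
    intro i
    have h1 : (Pi.single i (1 : K) - Pi.single i0 (β i / β i0)) ∈ hyp β := by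
      rw [mem_hyp]
      simp [lin, Pi.single_apply, mul_sub, Finset.sum_sub_distrib]
      field_simp
      simp
    have h2 := h h1
    rw [mem_hyp] at h2
    simp [lin, Pi.single_apply, mul_sub, Finset.sum_sub_distrib] at h2
    rw [sub_eq_zero] at h2
    rw [h2]; ring
  simp only [lin, Finset.sum_mul]
  refine Finset.sum_congr rfl fun i _ => ?_
  rw [key i, C_mul]; ring

/-- Restriction to the hyperplane `ker a`. -/
lemma exists_restr {a : Fin ℓ → K} (ha : a ≠ 0) :
    ∃ (σ : Type) (φ : S K ℓ →ₐ[K] MvPolynomial σ K) (ψ : MvPolynomial σ K →ₐ[K] S K ℓ),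
      (∀ g, φ (ψ g) = g) ∧ (∀ f, φ f = 0 ↔ lin a ∣ f) ∧
      (∀ β, φ (lin β) ≠ 0 → Irreducible (φ (lin β))) := by
  obtain ⟨i0, hi0⟩ := Function.ne_iff.mp ha
  simp only [Pi.zero_apply, ne_eq] at hi0
  let φ : S K ℓ →ₐ[K] MvPolynomial {i : Fin ℓ // i ≠ i0} K :=
    aeval fun i => if h : i = i0 then ∑ j : {i : Fin ℓ // i ≠ i0}, C (- a j / a i0) * X j
      else X ⟨i, h⟩
  let ψ : MvPolynomial {i : Fin ℓ // i ≠ i0} K →ₐ[K] S K ℓ := aeval fun j => X j.1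
  have hφψ : ∀ g, φ (ψ g) = g := by
    intro g
    have : φ.comp ψ = AlgHom.id K _ := by
      ext j
      simp [φ, ψ, j.2]
    exact DFunLike.congr_fun this g
  have hlin : φ (lin a) = 0 := by
    have : lin a = C (a i0) * X i0 + ∑ j : {i : Fin ℓ // i ≠ i0}, C (a j) * X j.1 := by
      rw [lin, Fintype.sum_eq_add_sum_subtype_ne _ i0]
    rw [this]
    simp only [φ, map_add, map_mul, map_sum, aeval_X, dif_pos, algHom_C, algebraMap_eq]
    rw [Finset.mul_sum, ← Finset.sum_add_distrib]
    apply Finset.sum_eq_zero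
    intro j _
    rw [dif_neg j.2, ← mul_assoc, ← C_mul]
    rw [show a i0 * (-a j / a i0) = - a j by field_simp]
    simp
  have hker : ∀ f, lin a ∣ f - ψ (φ f) := by
    intro f
    rw [← Ideal.mem_span_singleton, ← Ideal.Quotient.eq]
    have : (Ideal.Quotient.mkₐ K (Ideal.span {lin a})) =
        ((Ideal.Quotient.mkₐ K (Ideal.span {lin a})).comp ψ).comp φ := by
      ext i
      simp only [Ideal.Quotient.mkₐ_eq_mk, AlgHom.comp_apply]
      rw [Ideal.Quotient.eq, Ideal.mem_span_singleton]
      by_cases h : i = i0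
      · subst h
        refine ⟨C (1 / a i), ?_⟩
        have : lin a = C (a i) * X i + ∑ j : {k : Fin ℓ // k ≠ i}, C (a j) * X j.1 := by
          rw [lin, Fintype.sum_eq_add_sum_subtype_ne _ i]
        rw [this]
        simp only [φ, ψ, map_mul, map_sum, aeval_X, dif_pos, algHom_C, algebraMap_eq]
        rw [add_mul, Finset.sum_mul, sub_eq_add_neg, ← Finset.sum_neg_distrib]
        congr 1
        · rw [mul_right_comm, ← C_mul, mul_one_div_cancel hi0]; simp
        · refine Finset.sum_congr rfl fun j _ => ?_
          rw [mul_right_comm, ← C_mul, ← neg_mul, ← C_neg]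
          congr 2
          ring
      · simp [φ, ψ, h]
    exact DFunLike.congr_fun this f
  refine ⟨_, φ, ψ, hφψ, fun f => ⟨fun h => ?_, fun ⟨r, hr⟩ => ?_⟩, fun β hβ => ?_⟩
  · simpa [h] using hker f
  · rw [hr, map_mul, hlin, zero_mul]
  · apply irred_of_homog_one _ hβ
    simp only [lin, map_sum, map_mul, algHom_C, algebraMap_eq]
    refine IsHomogeneous.sum _ _ _ fun i _ => ?_
    refine IsHomogeneous.C_mul ?_ _
    simp only [φ, aeval_X]
    split_ifs
    · exact IsHomogeneous.sum _ _ _ fun i _ => isHomogeneous_C_mul_X _ _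
    · exact isHomogeneous_X _ _

lemma comp_mul_of_le {σ : Type*} {f g : MvPolynomial σ K} {m n : ℕ} (hf : f.IsHomogeneous m)
    (h : m ≤ n) :
    homogeneousComponent n (f * g) = f * homogeneousComponent (n - m) g := by
  let _ := MvPolynomial.gradedAlgebra (σ := σ) (R := K)
  have e : ∀ (h : MvPolynomial σ K) (i : ℕ),
      ((DirectSum.decompose (homogeneousSubmodule σ K) h) i : MvPolynomial σ K) =
        homogeneousComponent i h := fun h i => decomposition.decompose'_apply h i
  have := DirectSum.coe_decompose_mul_of_left_mem_of_le (homogeneousSubmodule σ K) (b := g)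
    (show f ∈ homogeneousSubmodule σ K m from hf) h
  simpa only [e] using this

lemma comp_mul_of_not_le {σ : Type*} {f g : MvPolynomial σ K} {m n : ℕ} (hf : f.IsHomogeneous m)
    (h : ¬ m ≤ n) :
    homogeneousComponent n (f * g) = 0 := by
  let _ := MvPolynomial.gradedAlgebra (σ := σ) (R := K)
  have e : ∀ (h : MvPolynomial σ K) (i : ℕ),
      ((DirectSum.decompose (homogeneousSubmodule σ K) h) i : MvPolynomial σ K) =
        homogeneousComponent i h := fun h i => decomposition.decompose'_apply h i
  have := DirectSum.coe_decompose_mul_of_left_mem_of_not_le (homogeneousSubmodule σ K) (b := g)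
    (show f ∈ homogeneousSubmodule σ K m from hf) h
  simpa only [e] using this

lemma dvd_comp {σ : Type*} {f g : MvPolynomial σ K} {m : ℕ} (n : ℕ) (hf : f.IsHomogeneous m)
    (h : f ∣ g) : f ∣ homogeneousComponent n g := by
  obtain ⟨r, rfl⟩ := h
  by_cases hmn : m ≤ n
  · rw [comp_mul_of_le hf hmn]; exact dvd_mul_right _ _
  · rw [comp_mul_of_not_le hf hmn]; exact dvd_zero _

lemma applyD_comp (θ : Deriv K ℓ) (β : Fin ℓ → K) (n : ℕ) :
    applyD (fun i => homogeneousComponent n (θ i)) β = homogeneousComponent n (applyD θ β) := by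
  simp [applyD, map_sum, homogeneousComponent_C_mul]

lemma comp_mem {B : Finset (Fin ℓ → K)} {θ : Deriv K ℓ} (n : ℕ) (h : θ ∈ logDer B) :
    (fun i => homogeneousComponent n (θ i)) ∈ logDer B := by
  intro β hβ
  rw [applyD_comp]
  exact dvd_comp n (lin_homog β) (h β hβ)

lemma applyD_const_smul (f : S K ℓ) (v β : Fin ℓ → K) :
    applyD (f • (fun i => C (v i) : Deriv K ℓ)) β = f * C (eval v (lin β)) := by
  rw [applyD_smul]
  simp [applyD, lin, map_sum]

lemma applyD_sub (θ η : Deriv K ℓ) (α : Fin ℓ → K) :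
    applyD (θ - η) α = applyD θ α - applyD η α := by
  simp [applyD, mul_sub, Finset.sum_sub_distrib]

lemma applyD_euler (β : Fin ℓ → K) : applyD (eulerD K ℓ) β = lin β := rfl

lemma mem_span_coeff {b : Fin ℓ → Deriv K ℓ} {B : Finset (Fin ℓ → K)}
    (hb : IsBasisOf b (logDer B)) {ξ : Deriv K ℓ} (h : ξ ∈ logDer B) :
    ∃ c : Fin ℓ → S K ℓ, ∑ i, c i • b i = ξ := by
  rw [← hb.2.2] at h
  exact (Submodule.mem_span_range_iff_exists_fun _).mp h

lemma coeff_unique {b : Fin ℓ → Deriv K ℓ} {B : Finset (Fin ℓ → K)}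
    (hb : IsBasisOf b (logDer B)) {c c' : Fin ℓ → S K ℓ}
    (h : ∑ i, c i • b i = ∑ i, c' i • b i) (i : Fin ℓ) : c i = c' i := by
  have := Fintype.linearIndependent_iff.mp hb.2.1 (fun i => c i - c' i)
    (by simp [sub_smul, Finset.sum_sub_distrib, h]) i
  exact sub_eq_zero.mp this

/-- The image of `D(A ∖ a)` under `η ↦ η(a)|_H` is a principal ideal if `A` is free. -/
lemma exists_generator {A : Finset (Fin ℓ → K)} {a : Fin ℓ → K} (ha : a ≠ 0)
    (haA : a ∈ A) (hA0 : ∀ β ∈ A, β ≠ 0)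
    (hNP : ∀ β ∈ A.erase a, ¬ lin a ∣ lin β) {b : Fin ℓ → Deriv K ℓ}
    (hb : IsBasisOf b (logDer A)) {σ : Type} (φ : S K ℓ →ₐ[K] MvPolynomial σ K)
    (ψ : MvPolynomial σ K →ₐ[K] S K ℓ) (hφψ : ∀ g, φ (ψ g) = g)
    (hφ : ∀ f, φ f = 0 ↔ lin a ∣ f) :
    ∃ η ∈ logDer (A.erase a), ∀ ζ ∈ logDer (A.erase a), φ (applyD η a) ∣ φ (applyD ζ a) := by
  by_cases hall : ∀ ζ ∈ logDer (A.erase a), φ (applyD ζ a) = 0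
  · exact ⟨0, Submodule.zero_mem _, fun ζ hζ => by rw [hall ζ hζ]; exact dvd_zero _⟩
  push Not at hall
  obtain ⟨ζ₁, hζ₁, hne⟩ := hall
  have hprime := lin_prime ha
  have hαmem : ∀ ζ ∈ logDer (A.erase a), lin a • ζ ∈ logDer A := by
    intro ζ hζ β hβ
    rw [applyD_smul]
    by_cases h : β = a
    · rw [h]; exact dvd_mul_right _ _
    · exact (hζ β (Finset.mem_erase.mpr ⟨h, hβ⟩)).mul_left _
  have hmem : ∀ ζ ∈ logDer (A.erase a), lin a ∣ applyD ζ a → ζ ∈ logDer A := by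
    intro ζ hζ hd β hβ
    by_cases h : β = a
    · rw [h]; exact hd
    · exact hζ β (Finset.mem_erase.mpr ⟨h, hβ⟩)
  have hdvdsub : ∀ f, lin a ∣ f - ψ (φ f) := by
    intro f
    rw [← hφ, map_sub, hφψ, sub_self]
  obtain ⟨f, hf⟩ := mem_span_coeff hb (hαmem ζ₁ hζ₁)
  let _ : StrongNormalizationMonoid (MvPolynomial σ K) :=
    UniqueFactorizationMonoid.strongNormalizationMonoid
  let _ : NormalizedGCDMonoid (MvPolynomial σ K) :=
    UniqueFactorizationMonoid.toNormalizedGCDMonoid _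
  obtain ⟨i0, -⟩ := Function.ne_iff.mp ha
  obtain ⟨e, he, hgcd⟩ := Finset.extract_gcd (s := Finset.univ) (fun i => φ (f i)) ⟨i0, Finset.mem_univ _⟩
  set h := Finset.univ.gcd (fun i => φ (f i)) with hh
  have hh0 : h ≠ 0 := by
    intro h0
    apply hne
    rw [hφ]
    have : ∀ i, lin a ∣ f i := by
      intro i
      rw [← hφ, he i (Finset.mem_univ _), h0, zero_mul]
    choose s hs using this
    have h2 : lin a • ζ₁ = lin a • ∑ i, s i • b i := by
      rw [← hf, Finset.smul_sum]
      refine Finset.sum_congr rfl fun i _ => ?_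
      rw [hs i, smul_smul]
    have h3 : ζ₁ = ∑ i, s i • b i := by
      funext t
      have := congrFun h2 t
      simp only [Pi.smul_apply, smul_eq_mul] at this
      exact mul_left_cancel₀ hprime.ne_zero this
    have h4 : ζ₁ ∈ logDer A := by
      rw [h3]
      exact Submodule.sum_mem _ fun i _ => Submodule.smul_mem _ _ (hb.1 i)
    exact h4 a haA
  have hω : ∀ t, lin a ∣ (∑ i, ψ (e i) • b i) t := by
    intro t
    have h1 : lin a ∣ ψ h * (∑ i, ψ (e i) • b i) t := by
      have h2 : ψ h * (∑ i, ψ (e i) • b i) t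
          = lin a * ζ₁ t - ∑ i, (f i - ψ (φ (f i))) * b i t := by
        have := congrFun hf t
        simp only [Finset.sum_apply, Pi.smul_apply, smul_eq_mul] at this ⊢
        rw [← this, Finset.mul_sum, ← Finset.sum_sub_distrib]
        refine Finset.sum_congr rfl fun i _ => ?_
        rw [he i (Finset.mem_univ _), map_mul]; ring
      rw [h2]
      exact dvd_sub (dvd_mul_right _ _) (Finset.dvd_sum fun i _ => (hdvdsub _).mul_right _)
    rcases hprime.dvd_or_dvd h1 with h2 | h2
    · rw [← hφ, hφψ] at h2
      exact absurd h2 hh0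
    · exact h2
  choose η hη using hω
  have hη' : lin a • η = ∑ i, ψ (e i) • b i := by
    funext t
    rw [hη t]; rfl
  have hηmem : η ∈ logDer (A.erase a) := by
    intro β hβ
    have h1 : lin a • η ∈ logDer A := by
      rw [hη']
      exact Submodule.sum_mem _ fun i _ => Submodule.smul_mem _ _ (hb.1 i)
    have h2 := h1 β (Finset.mem_of_mem_erase hβ)
    rw [applyD_smul] at h2
    have hβ0 := lin_prime (hA0 β (Finset.mem_of_mem_erase hβ))
    rcases hβ0.dvd_or_dvd h2 with h3 | h3
    · exact absurd (hβ0.irreducible.dvd_symm hprime.irreducible h3) (hNP β hβ)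
    · exact h3
  refine ⟨η, hηmem, fun ζ hζ => ?_⟩
  obtain ⟨g, hg⟩ := mem_span_coeff hb (hαmem ζ hζ)
  have h1 : applyD ζ a • η - applyD η a • ζ ∈ logDer A := by
    apply hmem
    · exact Submodule.sub_mem _ (Submodule.smul_mem _ _ hηmem) (Submodule.smul_mem _ _ hζ)
    · rw [applyD_sub, applyD_smul, applyD_smul, mul_comm, sub_self]; exact dvd_zero _
  obtain ⟨s, hs⟩ := mem_span_coeff hb h1
  have h2 : ∑ i, (lin a * s i) • b i = ∑ i, (applyD ζ a * ψ (e i) - applyD η a * g i) • b i := by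
    simp only [sub_smul, mul_smul, Finset.sum_sub_distrib, ← Finset.smul_sum]
    rw [hs, hg, ← hη', smul_sub, smul_comm (lin a), smul_comm (lin a)]
  have h3 : ∀ i, φ (applyD η a) ∣ φ (applyD ζ a) * e i := by
    intro i
    have h4 := congrArg φ (coeff_unique hb h2 i)
    rw [map_mul, (hφ (lin a)).mpr dvd_rfl, zero_mul, map_sub, map_mul, map_mul, hφψ] at h4
    exact ⟨φ (g i), sub_eq_zero.mp h4.symm⟩
  have h5 := Finset.dvd_gcd (s := Finset.univ) (f := fun i => φ (applyD ζ a) * e i)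
    (fun i _ => h3 i)
  have h6 := h5.trans (Finset.gcd_mul_left' (s := Finset.univ) (f := e) (φ (applyD ζ a))).dvd
  rwa [hgcd, mul_one] at h6

lemma dvd_of_dvd_mul_erase {R : Type*} [CommRing R] [IsDomain R] [UniqueFactorizationMonoid R]
    {ι : Type*} [DecidableEq ι] (s : Finset ι) (hs : s.Nonempty) (γ : ι → R)
    (hγ : ∀ i ∈ s, Prime (γ i)) (hna : ∀ i ∈ s, ∀ j ∈ s, Associated (γ i) (γ j) → i = j)
    (g B : R) (h : ∀ i ∈ s, g ∣ B * ∏ j ∈ s.erase i, γ j) : g ∣ B := by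
  let _ : StrongNormalizationMonoid R := UniqueFactorizationMonoid.strongNormalizationMonoid
  let _ : NormalizedGCDMonoid R := UniqueFactorizationMonoid.toNormalizedGCDMonoid _
  have hu : IsUnit (s.gcd fun i => ∏ j ∈ s.erase i, γ j) := by
    obtain ⟨i0, hi0⟩ := hs
    by_contra hnu
    have hne : (s.gcd fun i => ∏ j ∈ s.erase i, γ j) ≠ 0 := by
      intro h0
      have := Finset.gcd_eq_zero_iff.mp h0 i0 hi0
      rw [Finset.prod_eq_zero_iff] at this
      obtain ⟨j, hj, hj0⟩ := this
      exact (hγ j (Finset.mem_of_mem_erase hj)).ne_zero hj0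
    obtain ⟨π, hπ, hd⟩ := WfDvdMonoid.exists_irreducible_factor hnu hne
    have hd' : ∀ i ∈ s, ∃ j ∈ s.erase i, Associated π (γ j) := by
      intro i hi
      have h1 := hd.trans (Finset.gcd_dvd hi)
      obtain ⟨j, hj, hj'⟩ := (hπ.prime.dvd_finsetProd_iff _).mp h1
      exact ⟨j, hj, hπ.associated_of_dvd (hγ j (Finset.mem_of_mem_erase hj)).irreducible hj'⟩
    obtain ⟨j, hj, hj'⟩ := hd' i0 hi0
    obtain ⟨k, hk, hk'⟩ := hd' j (Finset.mem_of_mem_erase hj)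
    exact (Finset.ne_of_mem_erase hk)
      (hna k (Finset.mem_of_mem_erase hk) j (Finset.mem_of_mem_erase hj) (hk'.symm.trans hj'))
  have h5 := Finset.dvd_gcd h
  have h6 := h5.trans (Finset.gcd_mul_left' (s := s) (f := fun i => ∏ j ∈ s.erase i, γ j) B).dvd
  exact (IsUnit.dvd_mul_right hu).mp h6

set_option maxHeartbeats 1000000 in
/-- Existence of the derivation `η` with `η(a)` equal to Terao's polynomial `B`. -/
lemma key {A : Finset (Fin ℓ → K)} {a : Fin ℓ → K} (haA : a ∈ A)
    (hA0 : ∀ β ∈ A, β ≠ 0) (hNP : ∀ β ∈ A.erase a, ¬ lin a ∣ lin β) {b : Fin ℓ → Deriv K ℓ}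
    (hb : IsBasisOf b (logDer A)) (hne : (A.erase a).Nonempty) (p : Fin ℓ → K)
    (hpa : p ∈ hyp a)
    (hp : ∀ β ∈ A.erase a, ∀ γ ∈ A.erase a, β ≠ γ → hyp a ⊓ hyp β = hyp a ⊓ hyp γ →
      p ∉ hyp β) :
    ∃ η ∈ logDer (A.erase a), IsHomog η ((A.erase a).card - (restH (A.erase a) a).card) ∧
      eval p (applyD η a) ≠ 0 := by
  have ha := hA0 a haA
  obtain ⟨σ, φ, ψ, hφψ, hφ, hirr⟩ := exists_restr ha
  obtain ⟨η, hη, hgen⟩ := exists_generator ha haA hA0 hNP hb φ ψ hφψ hφ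
  obtain ⟨Rp, hRs, hRinj, hRim⟩ := Finset.exists_subset_injOn_image_eq_of_surjOn
    (f := fun β => hyp a ⊓ hyp β) (A.erase a : Set (Fin ℓ → K)) (restH (A.erase a) a) (by
      intro x hx
      simpa [restH] using hx)
  have hRs' : Rp ⊆ A.erase a := by exact_mod_cast hRs
  have hRne : Rp.Nonempty := by
    rw [← Finset.image_nonempty (f := fun β => hyp a ⊓ hyp β), hRim]
    exact hne.image _
  have hRcard : Rp.card = (restH (A.erase a) a).card := by
    rw [← hRim, Finset.card_image_of_injOn hRinj]
  set B : S K ℓ := ∏ β ∈ A.erase a \ Rp, lin β with hB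
  have hBhom : B.IsHomogeneous ((A.erase a).card - (restH (A.erase a) a).card) := by
    have := IsHomogeneous.prod (A.erase a \ Rp) (fun β => lin β) (fun _ => 1)
      (fun β _ => lin_homog β)
    simpa [Finset.card_sdiff_of_subset hRs', hRcard] using this
  have hBp : eval p B ≠ 0 := by
    rw [hB, map_prod, Finset.prod_ne_zero_iff]
    intro β hβ
    rw [Finset.mem_sdiff] at hβ
    have h1 : hyp a ⊓ hyp β ∈ Rp.image (fun β => hyp a ⊓ hyp β) := by
      rw [hRim]; exact Finset.mem_image_of_mem (fun β => hyp a ⊓ hyp β) hβ.1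
    obtain ⟨γ, hγ, hγ'⟩ := Finset.mem_image.mp h1
    have := hp β hβ.1 γ (hRs' hγ) (by rintro rfl; exact hβ.2 hγ) hγ'.symm
    rwa [mem_hyp] at this
  have hdvd : φ (applyD η a) ∣ φ B := by
    refine dvd_of_dvd_mul_erase Rp hRne (fun β => φ (lin β)) ?_ ?_ _ _ ?_
    · intro β hβ
      exact (hirr β (by rw [Ne, hφ]; exact hNP β (hRs' hβ))).prime
    · intro β hβ γ hγ hass
      have hle : ∀ β γ : Fin ℓ → K, φ (lin β) ∣ φ (lin γ) → hyp a ⊓ hyp β ≤ hyp a ⊓ hyp γ := by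
        rintro β γ ⟨r, hr⟩ v hv
        refine ⟨hv.1, ?_⟩
        have h1 : lin a ∣ lin γ - lin β * ψ r := by
          rw [← hφ, map_sub, map_mul, hφψ, hr, sub_self]
        obtain ⟨t, ht⟩ := h1
        have h2 := mem_hyp.mp hv.1
        have h3 := mem_hyp.mp hv.2
        have := congrArg (eval v) ht
        rw [map_sub, map_mul, map_mul, h2, h3, zero_mul, zero_mul, sub_zero] at this
        exact mem_hyp.mpr this
      exact hRinj hβ hγ (le_antisymm (hle _ _ hass.dvd) (hle _ _ hass.symm.dvd))
    · intro β hβ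
      have hβ' := hRs' hβ
      have hβ0 := hA0 β (Finset.mem_of_mem_erase hβ')
      have hnle : ¬ hyp β ≤ hyp a := fun h =>
        hNP β hβ' ((lin_prime hβ0).irreducible.dvd_symm (lin_prime ha).irreducible
          (dvd_of_hyp_le hβ0 h))
      obtain ⟨v, hv, hva⟩ := SetLike.not_le_iff_exists.mp hnle
      rw [mem_hyp] at hv hva
      have hζ : (∏ γ ∈ (A.erase a).erase β, lin γ) • (fun i => C (v i) : Deriv K ℓ)
          ∈ logDer (A.erase a) := by
        intro γ hγ
        rw [applyD_const_smul]
        by_cases h : γ = β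
        · rw [h, hv]; simp
        · exact (Finset.dvd_prod_of_mem _ (Finset.mem_erase.mpr ⟨h, hγ⟩)).mul_right _
      have h1 := hgen _ hζ
      rw [applyD_const_smul] at h1
      have h2 : (∏ γ ∈ (A.erase a).erase β, lin γ) = B * ∏ γ ∈ Rp.erase β, lin γ := by
        rw [hB, ← Finset.prod_union]
        · congr 1
          ext γ
          simp only [Finset.mem_union, Finset.mem_sdiff, Finset.mem_erase]
          have : γ ∈ Rp → γ ≠ a ∧ γ ∈ A := fun h => Finset.mem_erase.mp (hRs' h)
          by_cases h : γ = β
          · subst h; simp [hβ]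
          · tauto
        · rw [Finset.disjoint_left]
          intro γ h3 h4
          exact (Finset.mem_sdiff.mp h3).2 (Finset.mem_of_mem_erase h4)
      rw [h2, map_mul, map_mul, map_prod φ (fun γ => lin γ) (Rp.erase β), algHom_C,
        algebraMap_eq] at h1
      have hu : IsUnit (C (eval v (lin a)) : MvPolynomial σ K) :=
        (isUnit_iff_ne_zero.mpr hva).map (C : K →+* MvPolynomial σ K)
      rwa [hu.dvd_mul_right] at h1
  obtain ⟨w, hw⟩ := hdvd
  set n := (A.erase a).card - (restH (A.erase a) a).card with hn
  refine ⟨fun i => homogeneousComponent n ((ψ w • η) i), comp_mem n (Submodule.smul_mem _ _ hη),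
    fun i => homogeneousComponent_isHomogeneous _ _, ?_⟩
  rw [applyD_comp, applyD_smul]
  have h1 : lin a ∣ ψ w * applyD η a - B := by
    rw [← hφ, map_sub, map_mul, hφψ, hw]; ring
  have h2 := dvd_comp n (lin_homog a) h1
  rw [map_sub, homogeneousComponent_eq_self hBhom] at h2
  obtain ⟨r, hr⟩ := h2
  have h3 := congrArg (eval p) hr
  rw [map_sub, map_mul (eval p) (lin a), mem_hyp.mp hpa, zero_mul, sub_eq_zero] at h3
  rw [h3]; exact hBp

/-- Replacing one basis element by an element with a unit coefficient there. -/
lemma basis_update {b : Fin ℓ → Deriv K ℓ} {B : Finset (Fin ℓ → K)}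
    (hb : IsBasisOf b (logDer B)) (k : Fin ℓ) (c : Fin ℓ → S K ℓ) (hc : IsUnit (c k)) :
    IsBasisOf (Function.update b k (∑ i, c i • b i)) (logDer B) := by
  have hmem : ∀ i, Function.update b k (∑ i, c i • b i) i ∈ logDer B := by
    intro i
    by_cases h : i = k
    · subst h
      rw [Function.update_self]
      exact Submodule.sum_mem _ fun i _ => Submodule.smul_mem _ _ (hb.1 i)
    · rw [Function.update_of_ne h]; exact hb.1 i
  have hsum : ∀ g : Fin ℓ → S K ℓ, ∑ i, g i • Function.update b k (∑ i, c i • b i) i =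
      ∑ i, (if i = k then g k * c k else g i + g k * c i) • b i := by
    intro g
    have e1 : ∀ i, (if i = k then g k * c k else g i + g k * c i) • b i =
        (if i = k then 0 else g i) • b i + g k • (c i • b i) := by
      intro i
      split_ifs with h
      · subst h; simp [mul_smul]
      · simp [add_smul, mul_smul]
    simp only [e1, Finset.sum_add_distrib, ← Finset.smul_sum]
    rw [← Finset.add_sum_erase _ _ (Finset.mem_univ k), Function.update_self, add_comm,
      ← Finset.add_sum_erase (Finset.univ) (fun i => (if i = k then 0 else g i) • b i)
        (Finset.mem_univ k)]
    simp only [if_true, zero_smul, zero_add]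
    congr 1
    refine Finset.sum_congr rfl fun i hi => ?_
    have := Finset.ne_of_mem_erase hi
    rw [Function.update_of_ne this, if_neg this]
  refine ⟨hmem, ?_, le_antisymm (Submodule.span_le.mpr (by rintro _ ⟨i, rfl⟩; exact hmem i)) ?_⟩
  · rw [Fintype.linearIndependent_iff]
    intro g hg
    rw [hsum g] at hg
    have h1 := Fintype.linearIndependent_iff.mp hb.2.1 _ hg
    have hk : g k = 0 := by
      have := h1 k
      rw [if_pos rfl] at this
      rcases mul_eq_zero.mp this with h | h
      · exact h
      · exact absurd h hc.ne_zero
    intro i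
    by_cases h : i = k
    · rw [h]; exact hk
    · have := h1 i
      simpa [h, hk] using this
  · intro ξ hξ
    obtain ⟨f, hf⟩ := mem_span_coeff hb hξ
    rw [Submodule.mem_span_range_iff_exists_fun]
    obtain ⟨u, hu⟩ := hc
    refine ⟨fun i => if i = k then f k * (↑u⁻¹ : S K ℓ) else f i - f k * (↑u⁻¹ : S K ℓ) * c i, ?_⟩
    rw [hsum, ← hf]
    refine Finset.sum_congr rfl fun i _ => ?_
    congr 1
    by_cases h : i = k
    · subst h; simp [← hu, mul_assoc]
    · simp [h]

lemma basis_perm {b : Fin ℓ → Deriv K ℓ} {B : Finset (Fin ℓ → K)}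
    (hb : IsBasisOf b (logDer B)) (e : Equiv.Perm (Fin ℓ)) :
    IsBasisOf (b ∘ e) (logDer B) := by
  refine ⟨fun i => hb.1 _, hb.2.1.comp _ e.injective, ?_⟩
  rw [e.surjective.range_comp, hb.2.2]

/-- Graded exchange lemma. -/
lemma exchange {b : Fin ℓ → Deriv K ℓ} {B : Finset (Fin ℓ → K)}
    (hb : IsBasisOf b (logDer B)) (e : Fin ℓ → ℕ) (he : ∀ i j, i ≤ j → e i ≤ e j)
    (hdeg : ∀ i, IsHomog (b i) (e i)) (k : Fin ℓ) (ω : Deriv K ℓ) (hω : ω ∈ logDer B)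
    (hωd : IsHomog ω (e k)) (hns : ω ∉ Submodule.span (S K ℓ) (b '' {i | i < k})) :
    ∃ b' : Fin ℓ → Deriv K ℓ, IsBasisOf b' (logDer B) ∧ (∀ i, IsHomog (b' i) (e i)) ∧
      b' k = ω ∧ ∀ i, i < k → b' i = b i := by
  obtain ⟨c, hc⟩ := mem_span_coeff hb hω
  let c' : Fin ℓ → S K ℓ := fun i =>
    if e i ≤ e k then homogeneousComponent (e k - e i) (c i) else 0
  have hc' : ∑ i, c' i • b i = ω := by
    funext t
    have h1 : ω t = homogeneousComponent (e k) (ω t) := (homogeneousComponent_eq_self (hωd t)).symm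
    rw [h1, ← hc]
    simp only [Finset.sum_apply, Pi.smul_apply, smul_eq_mul, map_sum]
    refine Finset.sum_congr rfl fun i _ => ?_
    rw [mul_comm (c i)]
    simp only [c']
    split_ifs with h
    · rw [comp_mul_of_le (hdeg i t) h, mul_comm]
    · rw [comp_mul_of_not_le (hdeg i t) h, zero_mul]
  have hex : ∃ i, k ≤ i ∧ c' i ≠ 0 := by
    by_contra hcon
    push Not at hcon
    apply hns
    rw [← hc']
    refine Submodule.sum_mem _ fun i _ => ?_
    by_cases h : i < k
    · exact Submodule.smul_mem _ _ (Submodule.subset_span ⟨i, h, rfl⟩)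
    · rw [hcon i (not_lt.mp h), zero_smul]; exact Submodule.zero_mem _
  obtain ⟨i, hki, hci⟩ := hex
  have hei : e i = e k := by
    by_contra hne
    apply hci
    have := he k i hki
    simp only [c']
    rw [if_neg (by omega)]
  have hunit : IsUnit (c' i) := by
    simp only [c', hei, le_refl, if_true, Nat.sub_self, homogeneousComponent_zero] at hci ⊢
    apply IsUnit.map
    rw [isUnit_iff_ne_zero]
    intro h0
    rw [h0, map_zero] at hci
    exact hci rfl
  have hb1 := basis_update hb i c' hunit
  rw [hc'] at hb1
  have hb2 := basis_perm hb1 (Equiv.swap i k)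
  refine ⟨_, hb2, ?_, ?_, ?_⟩
  · intro t
    simp only [Function.comp]
    rcases eq_or_ne t k with rfl | htk
    · rw [Equiv.swap_apply_right, Function.update_self]; exact hωd
    · rcases eq_or_ne t i with rfl | hti
      · rw [Equiv.swap_apply_left, Function.update_of_ne (Ne.symm htk), hei]
        exact hdeg k
      · rw [Equiv.swap_apply_of_ne_of_ne hti htk, Function.update_of_ne hti]; exact hdeg t
  · simp
  · intro t ht
    have h1 : t ≠ k := ne_of_lt ht
    have h2 : t ≠ i := ne_of_lt (lt_of_lt_of_le ht hki)
    simp only [Function.comp]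
    rw [Equiv.swap_apply_of_ne_of_ne h2 h1, Function.update_of_ne h2]

/-- Deleting one hyperplane. -/
lemma delete {b : Fin ℓ → Deriv K ℓ} {B : Finset (Fin ℓ → K)} {a : Fin ℓ → K}
    (ha : a ≠ 0) (haB : a ∈ B)
    (hNP : ∀ β ∈ B.erase a, ¬ lin a ∣ lin β)
    (hb : IsBasisOf b (logDer B)) (k : Fin ℓ) (η : Deriv K ℓ) (hη : η ∈ logDer (B.erase a))
    (hk : b k = lin a • η) :
    IsBasisOf (Function.update b k η) (logDer (B.erase a)) := by
  have hprime := lin_prime ha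
  have hle : logDer B ≤ logDer (B.erase a) := fun θ hθ β hβ => hθ β (Finset.mem_of_mem_erase hβ)
  have hmem : ∀ i, Function.update b k η i ∈ logDer (B.erase a) := by
    intro i
    by_cases h : i = k
    · subst h; rw [Function.update_self]; exact hη
    · rw [Function.update_of_ne h]; exact hle (hb.1 i)
  let M : Matrix (Fin ℓ) (Fin ℓ) (S K ℓ) := Matrix.of (Function.update b k η)
  have hdetb : (Matrix.of b).det = lin a * M.det := by
    have h1 : Matrix.of b = M.updateRow k (lin a • η) := by
      ext i j
      by_cases h : i = k
      · subst h; simp [hk]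
      · simp [h, M]
    have h2 : M = M.updateRow k η := by
      ext i j
      by_cases h : i = k
      · subst h; simp [M]
      · simp [h]
    rw [h1, Matrix.det_updateRow_smul, ← h2]
  obtain ⟨i0, hi0⟩ := Function.ne_iff.mp ha
  simp only [Pi.zero_apply, ne_eq] at hi0
  let R : S K ℓ := ∏ β ∈ B.erase a, lin β
  let v : Fin ℓ → S K ℓ := fun i => if i = i0 then lin a else C (- a i / a i0)
  let T : Matrix (Fin ℓ) (Fin ℓ) (S K ℓ) := R • (1 : Matrix (Fin ℓ) (Fin ℓ) (S K ℓ)).updateCol i0 v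
  have hTdet : T.det = R ^ ℓ * lin a := by
    simp only [T]
    rw [Matrix.det_smul, Fintype.card_fin, ← Matrix.cramer_apply, Matrix.cramer_one]
    simp [v]
  have hTmem : ∀ i, T i ∈ logDer B := by
    intro i β hβ
    by_cases h : β = a
    · subst h
      have hT : T i = R • ((1 : Matrix (Fin ℓ) (Fin ℓ) (S K ℓ)).updateCol i0 v i) := rfl
      rw [hT, applyD_smul]
      apply Dvd.dvd.mul_left
      simp only [applyD]
      rw [← Finset.add_sum_erase _ _ (Finset.mem_univ i0)]
      rw [Matrix.updateCol_self]
      have h1 : ∑ x ∈ Finset.univ.erase i0, C (β x) *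
          ((1 : Matrix (Fin ℓ) (Fin ℓ) (S K ℓ)).updateCol i0 v i x) =
          if i = i0 then 0 else C (β i) := by
        have h2 : ∀ x ∈ Finset.univ.erase i0, C (β x) *
          ((1 : Matrix (Fin ℓ) (Fin ℓ) (S K ℓ)).updateCol i0 v i x) = if i = x then C (β x) else 0 := by
          intro x hx
          rw [Matrix.updateCol_ne (Finset.ne_of_mem_erase hx), Matrix.one_apply]
          split_ifs <;> simp
        rw [Finset.sum_congr rfl h2, Finset.sum_ite_eq]
        by_cases h3 : i = i0 <;> simp [h3]
      rw [h1]
      by_cases h3 : i = i0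
      · simp [v, h3]
      · simp only [v, h3, if_false]
        rw [← C_mul, ← C_add, show β i0 * (-β i / β i0) + β i = 0 by field_simp; ring]
        simp
    · have hT : T i = R • ((1 : Matrix (Fin ℓ) (Fin ℓ) (S K ℓ)).updateCol i0 v i) := rfl
      rw [hT, applyD_smul]
      exact (Finset.dvd_prod_of_mem _ (Finset.mem_erase.mpr ⟨h, hβ⟩)).mul_right _
  choose G hG using fun i => mem_span_coeff hb (hTmem i)
  have hTG : T = Matrix.of G * Matrix.of b := by
    ext1 i j
    have := congrFun (hG i) j
    rw [← this, Matrix.mul_apply]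
    simp [Finset.sum_apply]
  have hMR : M.det ∣ R ^ ℓ := by
    have h1 : lin a * (M.det * (Matrix.of G).det) = lin a * R ^ ℓ := by
      rw [mul_comm (lin a) (R ^ ℓ), ← hTdet, hTG, Matrix.det_mul, hdetb]; ring
    exact ⟨_, (mul_left_cancel₀ hprime.ne_zero h1).symm⟩
  have hnd : ¬ lin a ∣ M.det := by
    intro h
    have h1 := hprime.dvd_of_dvd_pow (h.trans hMR)
    obtain ⟨β, hβ, hd⟩ := (hprime.dvd_finsetProd_iff _).mp h1
    exact hNP β hβ hd
  have hM0 : M.det ≠ 0 := fun h => hnd (h ▸ dvd_zero _)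
  refine ⟨hmem, Matrix.linearIndependent_rows_of_det_ne_zero hM0,
    le_antisymm (Submodule.span_le.mpr (by rintro _ ⟨i, rfl⟩; exact hmem i)) ?_⟩
  intro ξ hξ
  have hαξ : lin a • ξ ∈ logDer B := by
    intro β hβ
    rw [applyD_smul]
    by_cases h : β = a
    · rw [h]; exact dvd_mul_right _ _
    · exact (hξ β (Finset.mem_erase.mpr ⟨h, hβ⟩)).mul_left _
  obtain ⟨c, hc⟩ := mem_span_coeff hb hαξ
  let c' : Fin ℓ → S K ℓ := fun i => if i = k then lin a * c i else c i
  have hc' : ∑ i, c' i • M i = lin a • ξ := by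
    rw [← hc]
    refine Finset.sum_congr rfl fun i _ => ?_
    by_cases h : i = k
    · subst h
      have : M i = η := by funext j; simp [M]
      rw [this, hk, smul_smul]
      simp [c', mul_comm]
    · have : M i = b i := by
        funext j
        simp [M, h]
      rw [this]; simp [c', h]
  have hdv : ∀ i, lin a ∣ c' i := by
    intro i
    have h1 : Matrix.vecMul c' M = lin a • ξ := by
      rw [← hc']
      funext j
      simp [Matrix.vecMul, dotProduct, Finset.sum_apply]
    have h2 : Matrix.vecMul (lin a • ξ) M.adjugate = M.det • c' := by
      rw [← h1, Matrix.vecMul_vecMul, Matrix.mul_adjugate, Matrix.vecMul_smul, Matrix.vecMul_one]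
    have h3 := congrFun h2 i
    rw [Matrix.smul_vecMul] at h3
    simp only [Pi.smul_apply, smul_eq_mul] at h3
    rcases hprime.dvd_or_dvd (show lin a ∣ M.det * c' i from ⟨_, h3.symm⟩) with h | h
    · exact absurd h hnd
    · exact h
  choose s hs using hdv
  rw [Submodule.mem_span_range_iff_exists_fun]
  refine ⟨s, ?_⟩
  funext t
  have h1 := congrFun hc' t
  apply mul_left_cancel₀ hprime.ne_zero
  simp only [Finset.sum_apply, Pi.smul_apply, smul_eq_mul] at h1 ⊢
  rw [← h1, Finset.mul_sum]
  refine Finset.sum_congr rfl fun i _ => ?_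
  rw [hs i, mul_assoc]
  rfl

lemma finrank_hyp (β : Fin ℓ → K) : ℓ ≤ finrank K (hyp β) + 1 := by
  have h := LinearMap.finrank_range_add_finrank_ker
    (∑ i, β i • LinearMap.proj i : (Fin ℓ → K) →ₗ[K] K)
  have h' := Submodule.finrank_le
    (LinearMap.range (∑ i, β i • LinearMap.proj i : (Fin ℓ → K) →ₗ[K] K))
  rw [Module.finrank_self] at h'
  rw [Module.finrank_fin_fun] at h
  unfold hyp
  omega

lemma finrank_inf_hyp (Y : Submodule K (Fin ℓ → K)) (β : Fin ℓ → K) :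
    finrank K Y ≤ finrank K (hyp β ⊓ Y : Submodule K (Fin ℓ → K)) + 1 := by
  have h := Submodule.finrank_sup_add_finrank_inf_eq (hyp β) Y
  have h1 := finrank_hyp β
  have h2 := Submodule.finrank_le (hyp β ⊔ Y)
  rw [Module.finrank_fin_fun] at h2
  omega

lemma finrank_finset_inf (s : Finset ℕ) (α : ℕ → Fin ℓ → K) :
    ℓ ≤ finrank K (s.inf (fun j => hyp (α j)) : Submodule K (Fin ℓ → K)) + s.card := by
  induction s using Finset.induction_on with
  | empty => rw [Finset.inf_empty, finrank_top, Module.finrank_fin_fun]; simp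
  | insert a s ha ih =>
    rw [Finset.inf_insert, Finset.card_insert_of_notMem ha]
    have := finrank_inf_hyp (s.inf (fun j => hyp (α j))) (α a)
    omega

lemma not_inf_erase_le {q : ℕ} (hq2 : 2 ≤ q) (hqℓ : q ≤ ℓ) (α : ℕ → Fin ℓ → K)
    (h2 : codim ((Finset.Icc 2 q).inf (fun j => hyp (α j))) = q - 1) {k : ℕ}
    (hk : k ∈ Finset.Icc 2 q) :
    ¬ ((Finset.Icc 2 q).erase k).inf (fun j => hyp (α j)) ≤ hyp (α k) := by
  intro hle
  have h := finrank_finset_inf ((Finset.Icc 2 q).erase k) α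
  rw [Finset.card_erase_of_mem hk, Nat.card_Icc] at h
  have : (Finset.Icc 2 q).inf (fun j => hyp (α j)) =
      ((Finset.Icc 2 q).erase k).inf (fun j => hyp (α j)) := by
    conv_lhs => rw [← Finset.insert_erase hk]
    rw [Finset.inf_insert]
    exact inf_eq_right.2 hle
  rw [this] at h2
  unfold codim at h2
  omega

lemma smul_homog {f : S K ℓ} {η : Deriv K ℓ} {a b : ℕ} (hf : f.IsHomogeneous a)
    (hη : IsHomog η b) : IsHomog (f • η) (a + b) := fun i => by
  simpa using hf.mul (hη i)

lemma logDer_anti {A B : Finset (Fin ℓ → K)} (h : B ⊆ A) : logDer A ≤ logDer B :=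
  fun _ hθ β hβ => hθ β (h hβ)

/-- The shape of derivations in the span of the Euler derivation and multiples. -/
lemma span_shape {T : Set (Deriv K ℓ)} (p : Fin ℓ → K) (a : Fin ℓ → K)
    (hT : ∀ ξ ∈ T, ∃ (f : K) (g : S K ℓ), (∀ i, eval p (ξ i) = f * p i) ∧
      applyD ξ a = lin a * g ∧ eval p g = f) (ξ : Deriv K ℓ)
    (hξ : ξ ∈ Submodule.span (S K ℓ) T) :
    ∃ (f : K) (g : S K ℓ), (∀ i, eval p (ξ i) = f * p i) ∧
      applyD ξ a = lin a * g ∧ eval p g = f := by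
  induction hξ using Submodule.span_induction with
  | mem x h => exact hT x h
  | zero => exact ⟨0, 0, by simp, by simp [applyD], by simp⟩
  | add x y _ _ hx hy =>
    obtain ⟨f, g, h1, h2, h3⟩ := hx
    obtain ⟨f', g', h1', h2', h3'⟩ := hy
    refine ⟨f + f', g + g', fun i => ?_, ?_, by simp [h3, h3']⟩
    · simp [h1, h1', add_mul]
    · rw [applyD_add, h2, h2', mul_add]
  | smul c x _ hx =>
    obtain ⟨f, g, h1, h2, h3⟩ := hx
    refine ⟨eval p c * f, c * g, fun i => ?_, ?_, by simp [h3]⟩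
    · simp [h1, mul_assoc]
    · rw [applyD_smul, h2]; ring

lemma build {A : Finset (Fin ℓ → K)} {d : ℕ → ℕ} (hd1 : d 1 = 1)
    (hmono : ∀ i j, 1 ≤ i → i ≤ j → j ≤ ℓ → d i ≤ d j)
    (hfree : IsFreeWithExp A (fun i => d ((i : ℕ) + 1)))
    {q : ℕ} (hq2 : 2 ≤ q) (hqℓ : q ≤ ℓ) (α : ℕ → Fin ℓ → K) (η : ℕ → Deriv K ℓ)
    (hα0 : ∀ j ∈ Finset.Icc 2 q, α j ≠ 0)
    (hαA : ∀ j ∈ Finset.Icc 2 q, α j ∈ A)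
    (hdp : ∀ j ∈ Finset.Icc 2 q, 1 ≤ d j)
    (hη : ∀ j ∈ Finset.Icc 2 q, η j ∈ logDer (A.erase (α j)))
    (hηd : ∀ j ∈ Finset.Icc 2 q, IsHomog (η j) (d j - 1))
    (hNP : ∀ j ∈ Finset.Icc 2 q, ∀ β ∈ A.erase (α j), ¬ lin (α j) ∣ lin β)
    (hinj : ∀ j ∈ Finset.Icc 2 q, ∀ k ∈ Finset.Icc 2 q, α j = α k → j = k)
    (p : Fin ℓ → K) (hp0 : p ≠ 0) (hp : ∀ j ∈ Finset.Icc 2 q, p ∈ hyp (α j))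
    (hηp : ∀ j ∈ Finset.Icc 2 q, eval p (applyD (η j) (α j)) ≠ 0)
    (k : ℕ) (hk1 : 1 ≤ k) (hkq : k ≤ q) :
    ∃ b : Fin ℓ → Deriv K ℓ, IsBasisOf b (logDer A) ∧ (∀ i, IsHomog (b i) (d ((i : ℕ) + 1))) ∧
      (∀ i : Fin ℓ, (i : ℕ) = 0 → b i = eulerD K ℓ) ∧
      ∀ i : Fin ℓ, 1 ≤ (i : ℕ) → (i : ℕ) < k →
        b i = lin (α ((i : ℕ) + 1)) • η ((i : ℕ) + 1) := by
  have he : ∀ i j : Fin ℓ, i ≤ j → d ((i : ℕ) + 1) ≤ d ((j : ℕ) + 1) := fun i j hij =>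
    hmono _ _ (by omega) (by have := Fin.le_def.1 hij; omega) (by omega)
  induction k, hk1 using Nat.le_induction with
  | base =>
    obtain ⟨b, hb, hdeg⟩ := hfree
    have h0 : 0 < ℓ := by omega
    obtain ⟨b', hb', hd', hk', -⟩ := exchange hb (fun i : Fin ℓ => d ((i : ℕ) + 1)) he hdeg ⟨0, h0⟩
      (eulerD K ℓ) (fun β _ => by rw [applyD_euler])
      (fun i => by simpa [hd1, eulerD] using isHomogeneous_X K i) (by
        have : {i : Fin ℓ | i < ⟨0, h0⟩} = ∅ := by
          ext i; simp [Fin.lt_def]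
        rw [this]
        simp only [Set.image_empty, Submodule.span_empty, Submodule.mem_bot]
        intro h
        exact X_ne_zero (R := K) _ (congrFun h ⟨0, h0⟩))
    refine ⟨b', hb', hd', fun i hi => ?_, fun i h1 h2 => by omega⟩
    rw [← hk']; congr 1; exact Fin.ext hi
  | succ k hk1 ih =>
    obtain ⟨b, hb, hdeg, hb0, hbk⟩ := ih (by omega)
    have hkl : k < ℓ := by omega
    have hmem : k + 1 ∈ Finset.Icc 2 q := by simp; omega
    have hev : ∀ j ∈ Finset.Icc 2 q, eval p (lin (α j)) = 0 := fun j hj => mem_hyp.1 (hp j hj)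
    have hωmem : lin (α (k+1)) • η (k+1) ∈ logDer A := by
      intro β hβ
      rw [applyD_smul]
      by_cases h : β = α (k+1)
      · rw [h]; exact dvd_mul_right _ _
      · exact (hη _ hmem β (Finset.mem_erase.2 ⟨h, hβ⟩)).mul_left _
    have hωd : IsHomog (lin (α (k+1)) • η (k+1)) (d (k+1)) := by
      have := smul_homog (lin_homog (α (k+1))) (hηd _ hmem)
      rwa [Nat.add_sub_cancel' (hdp _ hmem)] at this
    obtain ⟨b', hb', hd', hk', hlt⟩ := exchange hb (fun i : Fin ℓ => d ((i : ℕ) + 1)) he hdeg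
      ⟨k, hkl⟩ (lin (α (k+1)) • η (k+1)) hωmem hωd (by
        intro hsp
        obtain ⟨f, g, h1, h2, h3⟩ := span_shape p (α (k+1)) (by
          rintro _ ⟨i, hi, rfl⟩
          have hi' : (i : ℕ) < k := hi
          by_cases h0 : (i : ℕ) = 0
          · rw [hb0 i h0]
            exact ⟨1, 1, by simp [eulerD], by rw [applyD_euler, mul_one], by simp⟩
          · have hm : (i : ℕ) + 1 ∈ Finset.Icc 2 q := by simp; omega
            rw [hbk i (by omega) hi']
            have hne : α (k+1) ≠ α ((i : ℕ) + 1) := fun h => by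
              have := hinj _ hmem _ hm h
              omega
            obtain ⟨g, hg⟩ := hη _ hm (α (k+1)) (Finset.mem_erase.2 ⟨hne, hαA _ hmem⟩)
            refine ⟨0, lin (α ((i : ℕ) + 1)) * g, ?_, ?_, ?_⟩
            · intro t; simp [hev _ hm]
            · rw [applyD_smul, hg]; ring
            · simp [hev _ hm]) _ hsp
        have hf : f = 0 := by
          by_contra hf
          apply hp0
          funext i
          have := h1 i
          simp only [Pi.smul_apply, smul_eq_mul, map_mul, hev _ hmem, zero_mul] at this
          simpa [hf] using this.symm
        rw [applyD_smul] at h2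
        have := mul_left_cancel₀ (lin_prime (hα0 _ hmem)).ne_zero h2
        apply hηp _ hmem
        rw [this, h3, hf])
    refine ⟨b', hb', hd', fun i hi => ?_, fun i h1 h2 => ?_⟩
    · rw [hlt i (by rw [Fin.lt_def]; simp; omega), hb0 i hi]
    · by_cases h : (i : ℕ) = k
      · have : i = ⟨k, hkl⟩ := Fin.ext h
        rw [this, hk']
      · rw [hlt i (by rw [Fin.lt_def]; simp; omega), hbk i h1 (by omega)]

end basics

end ArrPaper


open ArrPaper in
/-- Corollary of MDT: under the MDT hypotheses, all intermediate
deletions `𝒜₋I` are free with explicit bases. -/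
theorem stmt6 {K : Type*} [Field K] {ℓ : ℕ} (A : Finset (Fin ℓ → K))
    (hA0 : ∀ α ∈ A, α ≠ 0)
    (d : ℕ → ℕ) (hd1 : d 1 = 1)
    (hmono : ∀ i j, 1 ≤ i → i ≤ j → j ≤ ℓ → d i ≤ d j) (hd2 : 1 < d 2)
    (hfree : IsFreeWithExp A (fun i => d ((i : ℕ) + 1)))
    (q : ℕ) (hq2 : 2 ≤ q) (hqℓ : q ≤ ℓ)
    (α : ℕ → (Fin ℓ → K)) (hαA : ∀ j ∈ Finset.Icc 2 q, α j ∈ A)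
    (A' : Finset (Fin ℓ → K)) (hA' : A' = A \ (Finset.Icc 2 q).image α)
    (h1 : ∀ j ∈ Finset.Icc 2 q, A.card = (restH (A.erase (α j)) (α j)).card + d j)
    (Xs : Submodule K (Fin ℓ → K)) (hXs : Xs = (Finset.Icc 2 q).inf (fun j => hyp (α j)))
    (h2 : codim Xs = q - 1)
    (h3 : ¬ (Xs : Set (Fin ℓ → K)) ⊆ ⋃ β ∈ A', (hyp β : Set (Fin ℓ → K))) :
    ∃ η θ : ℕ → Deriv K ℓ,
      (∀ j ∈ Finset.Icc 2 q, IsHomog (η j) (d j - 1)) ∧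
      (∀ j ∈ Finset.Icc (q+1) ℓ, IsHomog (θ j) (d j)) ∧
      IsBasisOf (fun i : Fin ℓ =>
        if (i : ℕ) = 0 then eulerD K ℓ
        else if (i : ℕ) + 1 ≤ q then lin (α ((i : ℕ) + 1)) • η ((i : ℕ) + 1)
        else θ ((i : ℕ) + 1)) (logDer A) ∧
      ∀ I ⊆ Finset.Icc 2 q,
        IsBasisOf (fun i : Fin ℓ =>
          if (i : ℕ) = 0 then eulerD K ℓ
          else if (i : ℕ) + 1 ≤ q then
            (if (i : ℕ) + 1 ∈ I then η ((i : ℕ) + 1)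
             else lin (α ((i : ℕ) + 1)) • η ((i : ℕ) + 1))
          else θ ((i : ℕ) + 1)) (logDer (A \ I.image α)) := by
  have hni : ∀ k ∈ Finset.Icc 2 q,
      ¬ ((Finset.Icc 2 q).erase k).inf (fun j => hyp (α j)) ≤ hyp (α k) := fun k hk =>
    not_inf_erase_le hq2 hqℓ α (hXs ▸ h2) hk
  have hpair : ∀ j ∈ Finset.Icc 2 q, ∀ k ∈ Finset.Icc 2 q, j ≠ k →
      ¬ hyp (α j) ≤ hyp (α k) := fun j hj k hk hjk hle =>
    hni k hk ((Finset.inf_le (f := fun j => hyp (α j)) (Finset.mem_erase.2 ⟨hjk, hj⟩)).trans hle)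
  have htrip : ∀ j ∈ Finset.Icc 2 q, ∀ k ∈ Finset.Icc 2 q, ∀ m ∈ Finset.Icc 2 q, j ≠ m → k ≠ m →
      ¬ hyp (α j) ⊓ hyp (α k) ≤ hyp (α m) := fun j hj k hk m hm hjm hkm hle =>
    hni m hm ((le_inf (Finset.inf_le (f := fun j => hyp (α j)) (Finset.mem_erase.2 ⟨hjm, hj⟩))
      (Finset.inf_le (f := fun j => hyp (α j)) (Finset.mem_erase.2 ⟨hkm, hk⟩))).trans hle)
  have hinj : ∀ j ∈ Finset.Icc 2 q, ∀ k ∈ Finset.Icc 2 q, α j = α k → j = k := by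
    intro j hj k hk h
    by_contra hjk
    exact hpair j hj k hk hjk (by rw [h])
  obtain ⟨p, hp0, hpX, hpA'⟩ : ∃ p : Fin ℓ → K, p ≠ 0 ∧ p ∈ Xs ∧ ∀ β ∈ A', p ∉ hyp β := by
    obtain ⟨p, hpX, hp⟩ := Set.not_subset.1 h3
    have hp' : ∀ β ∈ A', p ∉ hyp β := by simpa using hp
    by_cases h0 : p = 0
    · have hpos : 0 < finrank K Xs := by
        unfold codim at h2
        omega
      have hXne : Xs ≠ ⊥ := by
        rintro h
        rw [h, finrank_bot] at hpos
        exact lt_irrefl _ hpos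
      obtain ⟨x, hx, hx0⟩ := Submodule.exists_mem_ne_zero_of_ne_bot hXne
      refine ⟨x, hx0, hx, fun β hβ => ?_⟩
      exact absurd (by rw [h0]; exact Submodule.zero_mem _) (hp' β hβ)
    · exact ⟨p, h0, hpX, hp'⟩
  have hpα : ∀ j ∈ Finset.Icc 2 q, p ∈ hyp (α j) := fun j hj => by
    rw [hXs] at hpX
    exact (Finset.inf_le (f := fun j => hyp (α j)) hj) hpX
  have hcase : ∀ β ∈ A, p ∈ hyp β → ∃ k ∈ Finset.Icc 2 q, β = α k := by
    intro β hβ hpβ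
    by_contra hcon
    refine hpA' β ?_ hpβ
    rw [hA', Finset.mem_sdiff]
    refine ⟨hβ, fun hm => ?_⟩
    obtain ⟨k, hk, rfl⟩ := Finset.mem_image.1 hm
    exact hcon ⟨k, hk, rfl⟩
  have hNP : ∀ j ∈ Finset.Icc 2 q, ∀ β ∈ A.erase (α j), ¬ lin (α j) ∣ lin β := by
    intro j hj β hβ hdvd
    have hle := hyp_le_of_dvd hdvd
    obtain ⟨hne, hβA⟩ := Finset.mem_erase.1 hβ
    obtain ⟨k, hk, rfl⟩ := hcase β hβA (hle (hpα j hj))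
    exact hpair j hj k hk (fun h => hne (by rw [h])) hle
  have hdge : ∀ j ∈ Finset.Icc 2 q, 2 ≤ d j := fun j hj => by
    have hj' := Finset.mem_Icc.1 hj
    have := hmono 2 j (by omega) hj'.1 (by omega)
    omega
  have hkey : ∀ j ∈ Finset.Icc 2 q, ∃ η ∈ logDer (A.erase (α j)), IsHomog η (d j - 1) ∧
      eval p (applyD η (α j)) ≠ 0 := by
    intro j hj
    have hcard := Finset.card_erase_of_mem (hαA j hj)
    have h1j := h1 j hj
    have hdj := hdge j hj
    obtain ⟨b, hb, -⟩ := hfree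
    obtain ⟨η, hη, hηd, hηp⟩ := key (hαA j hj) hA0 (hNP j hj) hb
      (Finset.card_pos.1 (by omega)) p (hpα j hj) (by
        intro β hβ γ hγ hne heq hpβ
        obtain ⟨hβ1, hβA⟩ := Finset.mem_erase.1 hβ
        obtain ⟨hγ1, hγA⟩ := Finset.mem_erase.1 hγ
        have hpγ : p ∈ hyp γ := by
          have : p ∈ hyp (α j) ⊓ hyp β := ⟨hpα j hj, hpβ⟩
          rw [heq] at this
          exact this.2
        obtain ⟨k, hk, rfl⟩ := hcase β hβA hpβ
        obtain ⟨m, hm, rfl⟩ := hcase γ hγA hpγ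
        exact htrip j hj k hk m hm (fun h => hγ1 (by rw [h])) (fun h => hne (by rw [h]))
          (heq.le.trans inf_le_right))
    refine ⟨η, hη, ?_, hηp⟩
    convert hηd using 1
    omega
  choose! η hη hηd hηp using hkey
  obtain ⟨b, hb, hdeg, hb0, hbk⟩ := build hd1 hmono hfree hq2 hqℓ α η
    (fun j hj => hA0 _ (hαA j hj)) hαA (fun j hj => by have := hdge j hj; omega) hη hηd hNP hinj
    p hp0 hpα hηp q (by omega) le_rfl
  have hempty : b = fun i : Fin ℓ =>
        if (i : ℕ) = 0 then eulerD K ℓ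
        else if (i : ℕ) + 1 ≤ q then lin (α ((i : ℕ) + 1)) • η ((i : ℕ) + 1)
        else (fun j => if h : j - 1 < ℓ then b ⟨j - 1, h⟩ else 0) ((i : ℕ) + 1) := by
    funext i
    by_cases h0 : (i : ℕ) = 0
    · rw [if_pos h0, hb0 i h0]
    · rw [if_neg h0]
      by_cases h1 : (i : ℕ) + 1 ≤ q
      · rw [if_pos h1, hbk i (by omega) (by omega)]
      · rw [if_neg h1]
        simp
  refine ⟨η, fun j => if h : j - 1 < ℓ then b ⟨j - 1, h⟩ else 0, hηd, ?_, ?_, ?_⟩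
  · intro j hj
    have hj' := Finset.mem_Icc.1 hj
    have hlt : j - 1 < ℓ := by omega
    have := hdeg ⟨j - 1, hlt⟩
    simp only [dif_pos hlt]
    convert this using 1
    simp only
    congr 1
    omega
  · rw [← hempty]; exact hb
  · intro I
    generalize (fun j => if h : j - 1 < ℓ then b ⟨j - 1, h⟩ else 0) = θ at hempty ⊢
    induction I using Finset.induction_on with
    | empty =>
      intro _
      simp only [Finset.notMem_empty, if_false, Finset.image_empty, Finset.sdiff_empty]
      rw [← hempty]; exact hb
    | insert j I hjI ih =>
      intro hsub
      have hI : I ⊆ Finset.Icc 2 q := (Finset.subset_insert _ _).trans hsub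
      have hj : j ∈ Finset.Icc 2 q := hsub (Finset.mem_insert_self _ _)
      have hj' := Finset.mem_Icc.1 hj
      have hset : A \ (insert j I).image α = (A \ I.image α).erase (α j) := by
        ext β
        simp only [Finset.mem_sdiff, Finset.mem_image, Finset.mem_erase, Finset.mem_insert]
        constructor
        · rintro ⟨h, h'⟩
          exact ⟨fun e => h' ⟨j, Or.inl rfl, e.symm⟩, h, fun ⟨k, hk, e⟩ => h' ⟨k, Or.inr hk, e⟩⟩
        · rintro ⟨h, h', h''⟩
          refine ⟨h', ?_⟩
          rintro ⟨k, rfl | hk, e⟩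
          · exact h e.symm
          · exact h'' ⟨k, hk, e⟩
      have hsubA : (A \ I.image α).erase (α j) ⊆ A.erase (α j) :=
        Finset.erase_subset_erase _ Finset.sdiff_subset
      have hmem : α j ∈ A \ I.image α := by
        rw [Finset.mem_sdiff]
        refine ⟨hαA j hj, fun hm => ?_⟩
        obtain ⟨k, hk, e⟩ := Finset.mem_image.1 hm
        exact hjI (hinj k (hI hk) j hj e ▸ hk)
      have hlt : j - 1 < ℓ := by omega
      have hj1 : j - 1 + 1 = j := by omega
      have hdel := delete (hA0 _ (hαA j hj)) hmem (fun β hβ => hNP j hj β (hsubA hβ)) (ih hI)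
        ⟨j - 1, hlt⟩ (η j) (logDer_anti hsubA (hη j hj)) (by
          simp only [hj1]
          rw [if_neg (by omega), if_pos hj'.2, if_neg hjI])
      rw [hset]
      convert hdel using 1
      funext i
      by_cases hi : i = ⟨j - 1, hlt⟩
      · subst hi
        rw [Function.update_self]
        simp only [hj1]
        rw [if_neg (by omega), if_pos hj'.2, if_pos (Finset.mem_insert_self _ _)]
      · rw [Function.update_of_ne hi]
        have : (i : ℕ) + 1 ≠ j := fun h => hi (Fin.ext (by simp; omega))
        simp only [Finset.mem_insert, this, false_or]
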